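/- Let M = Z(α₁−α₂) + ⋯ + Z(α_{l−2}−α_{l−1}) + Zγ_{l−1} + Zγ_l ⊆ L. Then L = M + Zα₂, the quotient group L/M is cyclic of order l(l−1) generated by the coset of α₂, and α_i ∈ M + α₂ for 1 ≤ i ≤ l−1 while α_l ∈ M + (l−1)²α₂. -/

import Mathlib

/-- The standard basis vector `α_i` (0-indexed) of `L = ℤ^l`. -/
def al (l : ℕ) (i : ℕ) : Fin l → ℤ := fun j => if (j : ℕ) = i then 1 else 0

/-- `γ_r = α₁ + ⋯ + α_r - r·α_{r+1}` for `r ≤ l-1`, and `γ_l = α₁ + ⋯ + α_l`. -/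
def ga (l r : ℕ) : Fin l → ℤ :=
  fun j => if (j : ℕ) < r then 1 else if (j : ℕ) = r then -(r : ℤ) else 0

/-- `M = ℤ(α₁-α₂) + ⋯ + ℤ(α_{l-2}-α_{l-1}) + ℤγ_{l-1} + ℤγ_l`
(here `α_i` is 1-indexed, so `α_i - α_{i+1} = al l (i-1) - al l i`). -/
def M (l : ℕ) : Submodule ℤ (Fin l → ℤ) :=
  Submodule.span ℤ
    ({x | ∃ i : ℕ, 1 ≤ i ∧ i ≤ l - 2 ∧ x = al l (i - 1) - al l i} ∪
      {ga l (l - 1), ga l l})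

/-- The integer functional with `α_i ↦ 1` for `i ≤ m` and `α_{m+1} ↦ -m`. -/
def fl (m : ℕ) : (Fin (m + 1) → ℤ) →ₗ[ℤ] ℤ where
  toFun x := ∑ j : Fin m, x j.castSucc - m * x (Fin.last m)
  map_add' x y := by simp [Finset.sum_add_distrib]; ring
  map_smul' c x := by simp [← Finset.mul_sum]; ring

lemma fl_apply (m : ℕ) (x) : fl m x = ∑ j : Fin m, x j.castSucc - m * x (Fin.last m) := rfl

lemma fl_al (m i : ℕ) (hi : i < m) : fl m (al (m + 1) i) = 1 := by
  rw [fl_apply, Finset.sum_eq_single (⟨i, hi⟩ : Fin m)]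
  · simp [al, hi.ne']
  · intro b _ hb
    have : (b : ℕ) ≠ i := fun h => hb (Fin.ext h)
    simp [al, this]
  · simp

lemma fl_ga1 (m : ℕ) : fl m (ga (m + 1) m) = m * (m + 1) := by
  simp [fl_apply, ga]; ring

lemma fl_ga2 (m : ℕ) : fl m (ga (m + 1) (m + 1)) = 0 := by
  have h (j : Fin m) : (j : ℕ) < m + 1 := by omega
  simp [fl_apply, ga, h]

lemma step_mem (m i : ℕ) (h : i + 1 < m) : al (m + 1) i - al (m + 1) (i + 1) ∈ M (m + 1) :=
  Submodule.subset_span (Or.inl ⟨i + 1, by omega, by omega, by simp⟩)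

lemma ga1_mem (m : ℕ) : ga (m + 1) m ∈ M (m + 1) :=
  Submodule.subset_span (Or.inr (by simp))

lemma ga2_mem (m : ℕ) : ga (m + 1) (m + 1) ∈ M (m + 1) :=
  Submodule.subset_span (Or.inr (by simp))

lemma al_zero (m i : ℕ) (h : i < m) : al (m + 1) 0 - al (m + 1) i ∈ M (m + 1) := by
  induction i with
  | zero => simp
  | succ k ih =>
    have := add_mem (ih (by omega)) (step_mem m k h)
    simpa using this

lemma al_one (m i : ℕ) (hm : 2 ≤ m) (h : i < m) :
    al (m + 1) i - al (m + 1) 1 ∈ M (m + 1) := by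
  have := sub_mem (al_zero m 1 (by omega)) (al_zero m i h)
  simpa using this

lemma expand (m : ℕ) (x : Fin (m + 1) → ℤ) :
    x = ∑ j : Fin m, x j.castSucc • al (m + 1) j + x (Fin.last m) • al (m + 1) m := by
  have h : x = ∑ j : Fin (m + 1), x j • al (m + 1) j := by
    ext k
    simp [al, Finset.sum_apply, Fin.val_inj]
  conv_lhs => rw [h, Fin.sum_univ_castSucc]
  simp

lemma al_last (m : ℕ) (hm : 2 ≤ m) : al (m + 1) m + (m : ℤ) • al (m + 1) 1 ∈ M (m + 1) := by
  have h1 : ∑ j : Fin m, (al (m + 1) j - al (m + 1) 1) ∈ M (m + 1) :=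
    sum_mem fun j _ => al_one m j hm j.2
  have h := sub_mem (ga2_mem m) h1
  have e := expand m (ga (m + 1) (m + 1))
  have h' (j : Fin m) : (j : ℕ) < m + 1 := by omega
  simp [ga, h'] at e
  convert h using 1
  rw [show ga (m + 1) (m + 1) = _ from e]
  simp [Finset.sum_sub_distrib]

lemma ord_mem (m : ℕ) (hm : 2 ≤ m) : ((m : ℤ) * (m + 1)) • al (m + 1) 1 ∈ M (m + 1) := by
  have h1 : ((m : ℤ) + 1) • al (m + 1) m ∈ M (m + 1) := by
    convert sub_mem (ga2_mem m) (ga1_mem m) using 1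
    ext j
    have := j.2
    simp only [al, ga, Pi.smul_apply, Pi.sub_apply, smul_eq_mul]
    split_ifs <;> omega
  have h2 := (M (m + 1)).smul_mem ((m : ℤ) + 1) (al_last m hm)
  convert sub_mem h2 h1 using 1
  module

lemma sub_fl_mem (m : ℕ) (hm : 2 ≤ m) (x : Fin (m + 1) → ℤ) :
    x - fl m x • al (m + 1) 1 ∈ M (m + 1) := by
  have h1 : ∑ j : Fin m, x j.castSucc • (al (m + 1) j - al (m + 1) 1) ∈ M (m + 1) :=
    sum_mem fun j _ => Submodule.smul_mem _ _ (al_one m j hm j.2)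
  have h2 := (M (m + 1)).smul_mem (x (Fin.last m)) (al_last m hm)
  convert add_mem h1 h2 using 1
  conv_lhs => rw [fl_apply]; enter [1]; rw [expand m x]
  simp only [smul_sub, Finset.sum_sub_distrib, ← Finset.sum_smul]
  module

lemma dvd_of_mem (m : ℕ) (x : Fin (m + 1) → ℤ) (hx : x ∈ M (m + 1)) :
    ((m : ℤ) * (m + 1)) ∣ fl m x := by
  refine Submodule.span_induction ?_ (by simp) (fun x y _ _ h1 h2 => by
    rw [map_add]; exact dvd_add h1 h2) (fun c x _ h => by
    rw [map_smul]; exact Dvd.dvd.mul_left h c) hx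
  rintro y (⟨i, h1, h2, rfl⟩ | h)
  · rw [map_sub, fl_al _ _ (by omega), fl_al _ _ (by omega)]; simp
  · rcases h with rfl | h
    · simp [fl_ga1]
    · rw [Set.mem_singleton_iff] at h
      simp [h, fl_ga2]

lemma mem_iff (m : ℕ) (hm : 2 ≤ m) (x : Fin (m + 1) → ℤ) :
    x ∈ M (m + 1) ↔ ((m : ℤ) * (m + 1)) ∣ fl m x := by
  refine ⟨dvd_of_mem m x, ?_⟩
  rintro ⟨c, hc⟩
  have h := add_mem (sub_fl_mem m hm x) ((M (m + 1)).smul_mem c (ord_mem m hm))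
  convert h using 1
  rw [hc]
  module

lemma card_quot (m : ℕ) (hm : 2 ≤ m) :
    Nat.card ((Fin (m + 1) → ℤ) ⧸ M (m + 1)) = (m + 1) * m := by
  let g : (Fin (m + 1) → ℤ) →ₗ[ℤ] ZMod ((m + 1) * m) :=
    (Int.castAddHom (ZMod ((m + 1) * m))).toIntLinearMap ∘ₗ fl m
  have hg (x) : g x = ((fl m x : ℤ) : ZMod ((m + 1) * m)) := rfl
  have hk : M (m + 1) = LinearMap.ker g := by
    ext x
    rw [mem_iff m hm, LinearMap.mem_ker, hg, ZMod.intCast_zmod_eq_zero_iff_dvd]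
    push_cast
    rw [mul_comm]
  have hs : Function.Surjective g := by
    intro y
    obtain ⟨n, rfl⟩ := ZMod.intCast_surjective y
    refine ⟨n • al (m + 1) 1, ?_⟩
    rw [hg, map_smul, fl_al _ _ (by omega)]
    simp
  rw [hk, Nat.card_congr (g.quotKerEquivOfSurjective hs).toEquiv, Nat.card_zmod]

/-- `L = M + ℤα₂`; the quotient `L/M` is cyclic of order `l(l-1)` generated by
the coset of `α₂`; `α_i ∈ M + α₂` for `1 ≤ i ≤ l-1`; and `α_l ∈ M + (l-1)²α₂`. -/
theorem stmt10 (l : ℕ) (hl : 3 ≤ l) :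
    M l ⊔ Submodule.span ℤ {al l 1} = ⊤ ∧
    Nat.card ((Fin l → ℤ) ⧸ M l) = l * (l - 1) ∧
    (∀ x : Fin l → ℤ, ∃ n : ℤ, x - n • al l 1 ∈ M l) ∧
    (∀ i : ℕ, 1 ≤ i → i ≤ l - 1 → al l (i - 1) - al l 1 ∈ M l) ∧
    al l (l - 1) - (((l - 1 : ℕ) : ℤ) ^ 2) • al l 1 ∈ M l := by
  obtain ⟨m, rfl⟩ : ∃ m, l = m + 1 := ⟨l - 1, by omega⟩
  have hm : 2 ≤ m := by omega
  simp only [Nat.add_sub_cancel]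
  refine ⟨?_, card_quot m hm, fun x => ⟨_, sub_fl_mem m hm x⟩,
    fun i h1 h2 => al_one m (i - 1) hm (by omega), ?_⟩
  · rw [eq_top_iff]
    intro x _
    rw [Submodule.mem_sup]
    exact ⟨_, sub_fl_mem m hm x, _,
      Submodule.smul_mem _ (fl m x) (Submodule.mem_span_singleton_self _), by simp⟩
  · convert sub_mem (al_last m hm) (ord_mem m hm) using 1
    module
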